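/- arXiv:1808.02516 — 4 statements merged into one kernel-verified Lean document; each statement's English description precedes it below -/
import Mathlib

section
/- Let H₀, H₁, …, H_m, P be Hermitian matrices in Matrix (Fin n) (Fin n) ℂ with H₀P = PH₀, let K > 0 be real, and let Ψ : ℝ → EuclideanSpace ℂ (Fin n) be differentiable and satisfy the closed-loop Schrödinger equation Ψ'(t) = −i·(H₀ + Σ_{k=1}^m f_k(t) H_k) Ψ(t), where the control fields are defined in feedback form by f_k(t) = −K · Re ⟨Ψ(t), i·(H_k P − P H_k) Ψ(t)⟩. Then the Lyapunov function V(t) = ⟨Ψ(t), P Ψ(t)⟩ is differentiable with V'(t) = −K⁻¹ Σ_{k=1}^m f_k(t)² ≤ 0 for all t. -/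
open scoped InnerProductSpace ComplexInnerProductSpace

namespace Matrix

variable {n : Type*} [Fintype n]

lemma IsHermitian.I_smul_commutator {A B : Matrix n n ℂ} (hA : A.IsHermitian)
    (hB : B.IsHermitian) : (Complex.I • (A * B - B * A)).IsHermitian := by
  simp [IsHermitian, conjTranspose_smul, conjTranspose_mul, hA.eq, hB.eq, ← smul_neg]

variable [DecidableEq n]

/-- The adjoint identity for a Hermitian matrix acting on Euclidean space. -/
lemma IsHermitian.inner_toEuclideanLin {A : Matrix n n ℂ} (hA : A.IsHermitian)
    (x y : EuclideanSpace ℂ n) :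
    ⟪toEuclideanLin A x, y⟫_ℂ = ⟪x, toEuclideanLin A y⟫_ℂ :=
  isSymmetric_toEuclideanLin_iff.mpr hA x y

lemma toEuclideanLin_mul_apply (A B : Matrix n n ℂ) (x : EuclideanSpace ℂ n) :
    toEuclideanLin (A * B) x = toEuclideanLin A (toEuclideanLin B x) := by
  ext i
  simp [toLpLin_apply, mulVec_mulVec]

lemma IsHermitian.ofReal_re_inner_toEuclideanLin {A : Matrix n n ℂ} (hA : A.IsHermitian)
    (x : EuclideanSpace ℂ n) :
    ((⟪x, toEuclideanLin A x⟫_ℂ).re : ℂ) = ⟪x, toEuclideanLin A x⟫_ℂ := by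
  rw [← Complex.conj_eq_iff_re, inner_conj_symm, hA.inner_toEuclideanLin]

/-- The Ehrenfest theorem for a time-independent observable `P`. -/
lemma IsHermitian.hasDerivAt_inner_toEuclideanLin {A P : Matrix n n ℂ} (hA : A.IsHermitian)
    {Ψ : ℝ → EuclideanSpace ℂ n} {t : ℝ}
    (hΨ : HasDerivAt Ψ ((-Complex.I) • toEuclideanLin A (Ψ t)) t) :
    HasDerivAt (fun s => ⟪Ψ s, toEuclideanLin P (Ψ s)⟫_ℂ)
      ⟪Ψ t, toEuclideanLin (Complex.I • (A * P - P * A)) (Ψ t)⟫_ℂ t := by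
  have hP := ((toEuclideanLin P).toContinuousLinearMap.restrictScalars ℝ).hasFDerivAt
    |>.comp_hasDerivAt t hΨ
  refine (hΨ.inner ℂ hP).congr_deriv ?_
  simp only [Function.comp_apply, ContinuousLinearMap.coe_restrictScalars',
    LinearMap.coe_toContinuousLinearMap', map_smul, map_sub, LinearMap.smul_apply,
    LinearMap.sub_apply, toEuclideanLin_mul_apply, inner_smul_left, inner_smul_right,
    inner_sub_right, hA.inner_toEuclideanLin, map_neg, Complex.conj_I]
  ring

end Matrix

/-- Closed-loop quantum Lyapunov control: with `[H₀, P] = 0`, `K > 0`, feedback control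
fields `f k t = -K * Re ⟪Ψ t, i (H k * P - P * H k) Ψ t⟫`, and dynamics
`Ψ' = -i (H₀ + ∑ k, f k t • H k) Ψ`, the Lyapunov function `V(t) = ⟪Ψ t, P Ψ t⟫` is
differentiable with `V'(t) = -K⁻¹ * ∑ k, (f k t)² ≤ 0`. -/
theorem stmt4 (n m : ℕ)
    (H₀ : Matrix (Fin n) (Fin n) ℂ) (hH₀ : H₀.IsHermitian)
    (H : Fin m → Matrix (Fin n) (Fin n) ℂ) (hH : ∀ k, (H k).IsHermitian)
    (P : Matrix (Fin n) (Fin n) ℂ) (hP : P.IsHermitian)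
    (hcomm : H₀ * P = P * H₀)
    (K : ℝ) (hK : 0 < K)
    (f : Fin m → ℝ → ℝ)
    (Ψ : ℝ → EuclideanSpace ℂ (Fin n))
    (hf : ∀ k t, f k t =
      -K * (⟪Ψ t, Matrix.toEuclideanLin (Complex.I • (H k * P - P * H k)) (Ψ t)⟫_ℂ).re)
    (hΨ : ∀ t, HasDerivAt Ψ
      ((-Complex.I) • Matrix.toEuclideanLin (H₀ + ∑ k, (f k t : ℂ) • H k) (Ψ t)) t) :
    ∀ t, HasDerivAt (fun s => (⟪Ψ s, Matrix.toEuclideanLin P (Ψ s)⟫_ℂ))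
        ((-K⁻¹ * ∑ k, (f k t) ^ 2 : ℝ) : ℂ) t
      ∧ (-K⁻¹ * ∑ k, (f k t) ^ 2 : ℝ) ≤ 0 := by
  intro t
  refine ⟨?_, mul_nonpos_of_nonpos_of_nonneg (by simpa using hK.le) (by positivity)⟩
  have hA : (H₀ + ∑ k, (f k t : ℂ) • H k).IsHermitian := by
    simp [Matrix.IsHermitian, Matrix.conjTranspose_sum, Matrix.conjTranspose_smul, hH₀.eq,
      fun k => (hH k).eq]
  have hcommutator : Complex.I • ((H₀ + ∑ k, (f k t : ℂ) • H k) * P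
        - P * (H₀ + ∑ k, (f k t : ℂ) • H k))
      = ∑ k, (f k t : ℂ) • (Complex.I • (H k * P - P * H k)) := by
    simp only [add_mul, mul_add, hcomm, add_sub_add_left_eq_sub, Finset.sum_mul, Finset.mul_sum,
      smul_mul_assoc, mul_smul_comm, ← Finset.sum_sub_distrib, ← smul_sub, Finset.smul_sum]
    exact Finset.sum_congr rfl fun k _ => smul_comm _ _ _
  refine (hA.hasDerivAt_inner_toEuclideanLin (P := P) (hΨ t)).congr_deriv ?_
  symm
  rw [hcommutator, map_sum, LinearMap.sum_apply, inner_sum, Complex.ofReal_mul,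
    Complex.ofReal_sum, Finset.mul_sum]
  refine Finset.sum_congr rfl fun k _ => ?_
  rw [map_smul, LinearMap.smul_apply, inner_smul_right,
    ← ((hH k).I_smul_commutator hP).ofReal_re_inner_toEuclideanLin, ← Complex.ofReal_mul,
    ← Complex.ofReal_mul]
  congr 1
  have hfield : (⟪Ψ t, Matrix.toEuclideanLin (Complex.I • (H k * P - P * H k)) (Ψ t)⟫_ℂ).re
      = -K⁻¹ * f k t := by
    rw [hf k t]
    field_simp
  rw [hfield]
  ring
end

section
/- Let H₀, H₁, …, H_m, P be Hermitian matrices in Matrix (Fin n) (Fin n) ℂ with H₀P = PH₀, let K > 0 be real, and let Ψ : ℝ → EuclideanSpace ℂ (Fin n) be differentiable and satisfy Ψ'(t) = −i·(H₀ + Σ_{k=1}^m f_k(t) H_k) Ψ(t) with f_k(t) = −K · Re ⟨Ψ(t), i·(H_k P − P H_k) Ψ(t)⟩. Then the function t ↦ ⟨Ψ(t), P Ψ(t)⟩ (which is real-valued) is nonincreasing on ℝ: for all s ≤ t, ⟨Ψ(t), P Ψ(t)⟩ ≤ ⟨Ψ(s), P Ψ(s)⟩. -/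
open scoped InnerProductSpace ComplexInnerProductSpace

/-- Ehrenfest's theorem for a time-independent observable `P`. -/
theorem hasDerivAt_inner_toEuclideanLin {n : ℕ} {A P : Matrix (Fin n) (Fin n) ℂ}
    (hA : A.IsHermitian) {Ψ : ℝ → EuclideanSpace ℂ (Fin n)} {t : ℝ}
    (hΨ : HasDerivAt Ψ ((-Complex.I) • Matrix.toEuclideanLin A (Ψ t)) t) :
    HasDerivAt (fun t => ⟪Ψ t, Matrix.toEuclideanLin P (Ψ t)⟫_ℂ)
      ⟪Ψ t, Matrix.toEuclideanLin (Complex.I • (A * P - P * A)) (Ψ t)⟫_ℂ t := by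
  have hPΨ := ((Matrix.toEuclideanLin P).toContinuousLinearMap.restrictScalars
    ℝ).hasFDerivAt.comp_hasDerivAt t hΨ
  have hAs := Matrix.isSymmetric_toEuclideanLin_iff.mpr hA
  refine (hΨ.inner ℂ hPΨ).congr_deriv ?_
  have h := hAs (Ψ t) (Matrix.toEuclideanLin P (Ψ t))
  simp [inner_smul_left, inner_smul_right, h]
  ring

/-- Along the closed-loop Lyapunov-controlled dynamics, the (real-valued) Lyapunov
function `t ↦ ⟪Ψ t, P Ψ t⟫` is nonincreasing. -/
theorem stmt5 (n m : ℕ)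
    (H₀ : Matrix (Fin n) (Fin n) ℂ) (hH₀ : H₀.IsHermitian)
    (H : Fin m → Matrix (Fin n) (Fin n) ℂ) (hH : ∀ k, (H k).IsHermitian)
    (P : Matrix (Fin n) (Fin n) ℂ) (hP : P.IsHermitian)
    (hcomm : H₀ * P = P * H₀)
    (K : ℝ) (hK : 0 < K)
    (f : Fin m → ℝ → ℝ)
    (Ψ : ℝ → EuclideanSpace ℂ (Fin n))
    (hf : ∀ k t, f k t =
      -K * (⟪Ψ t, Matrix.toEuclideanLin (Complex.I • (H k * P - P * H k)) (Ψ t)⟫_ℂ).re)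
    (hΨ : ∀ t, HasDerivAt Ψ
      ((-Complex.I) • Matrix.toEuclideanLin (H₀ + ∑ k, (f k t : ℂ) • H k) (Ψ t)) t) :
    ∀ s t : ℝ, s ≤ t →
      (⟪Ψ t, Matrix.toEuclideanLin P (Ψ t)⟫_ℂ).re ≤ (⟪Ψ s, Matrix.toEuclideanLin P (Ψ s)⟫_ℂ).re := by
  have hderiv : ∀ t, HasDerivAt (fun t => (⟪Ψ t, Matrix.toEuclideanLin P (Ψ t)⟫_ℂ).re)
      (∑ k, f k t *
        (⟪Ψ t, Matrix.toEuclideanLin (Complex.I • (H k * P - P * H k)) (Ψ t)⟫_ℂ).re) t := by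
    intro t
    have hA : (H₀ + ∑ k, (f k t : ℂ) • H k).IsHermitian := by
      refine hH₀.add (isSelfAdjoint_sum _ fun k _ => ?_)
      exact IsSelfAdjoint.smul (Complex.conj_ofReal _) (hH k)
    have hcommutator :
        Complex.I • ((H₀ + ∑ k, (f k t : ℂ) • H k) * P - P * (H₀ + ∑ k, (f k t : ℂ) • H k)) =
          ∑ k, (f k t : ℂ) • Complex.I • (H k * P - P * H k) := by
      simp only [add_mul, mul_add, hcomm, add_sub_add_left_eq_sub, Finset.sum_mul, Finset.mul_sum,
        ← Finset.sum_sub_distrib, Finset.smul_sum, smul_mul_assoc, mul_smul_comm, ← smul_sub]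
      exact Finset.sum_congr rfl fun k _ => smul_comm _ _ _
    have h := Complex.reCLM.hasFDerivAt.comp_hasDerivAt t
      (hasDerivAt_inner_toEuclideanLin (P := P) hA (hΨ t))
    refine h.congr_deriv ?_
    rw [hcommutator, map_sum, LinearMap.sum_apply, inner_sum, map_sum]
    refine Finset.sum_congr rfl fun k _ => ?_
    rw [map_smul, LinearMap.smul_apply, inner_smul_right, Complex.reCLM_apply,
      Complex.re_ofReal_mul]
  refine fun s t hst => antitone_of_hasDerivAt_nonpos hderiv (fun t => ?_) hst
  refine Finset.sum_nonpos fun k _ => ?_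
  rw [hf k t, mul_assoc, neg_mul]
  exact neg_nonpos.mpr (mul_nonneg hK.le (mul_self_nonneg _))
end

section
/- Let N ≥ 1, let X¹, …, X^N ∈ EuclideanSpace ℝ (Fin m) be training inputs with target outputs y¹, …, y^N ∈ ℝ, and fix an input X ∈ EuclideanSpace ℝ (Fin m). Suppose there is an index k₀ such that ‖X − X^{k₀}‖ < ‖X − X^k‖ for all k ≠ k₀ (a unique nearest training input). For σ > 0 let y(σ) = (Σ_{k=1}^N y^k exp(−‖X − X^k‖²/(2σ²)))/(Σ_{k=1}^N exp(−‖X − X^k‖²/(2σ²))) denote the GRNN output. Then y(σ) tends to y^{k₀} as σ → 0⁺. -/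
open Filter Topology in
/-- An exponentially weighted average concentrates on the unique minimiser of the exponent. -/
theorem tendsto_exp_weighted_average {ι : Type*} [Fintype ι] (a y : ι → ℝ) (i₀ : ι)
    (h : ∀ i, i ≠ i₀ → a i₀ < a i) :
    Tendsto (fun t : ℝ => (∑ i, y i * Real.exp (-a i * t)) / ∑ i, Real.exp (-a i * t))
      atTop (𝓝 (y i₀)) := by
  classical
  have hexp : ∀ i, Tendsto (fun t : ℝ => Real.exp (-(a i - a i₀) * t)) atTop
      (𝓝 (if i = i₀ then 1 else 0)) := by
    intro i
    split_ifs with hi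
    · simp [hi]
    · exact Real.tendsto_exp_atBot.comp
        (tendsto_id.const_mul_atTop_of_neg (by linarith [h i hi]))
  have hnum := tendsto_finsetSum Finset.univ fun i _ => (hexp i).const_mul (y i)
  have hden := tendsto_finsetSum Finset.univ fun i _ => hexp i
  have hquot := hnum.div hden (by simp)
  simp only [mul_ite, mul_one, mul_zero, Finset.sum_ite_eq', Finset.mem_univ, if_true,
    div_one] at hquot
  refine hquot.congr fun t => ?_
  have hshift : ∀ i, Real.exp (-(a i - a i₀) * t) = Real.exp (-a i * t) * Real.exp (a i₀ * t) := by
    intro i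
    rw [← Real.exp_add]
    ring_nf
  simp only [Pi.div_apply, hshift, ← mul_assoc, ← Finset.sum_mul]
  exact mul_div_mul_right _ _ (Real.exp_ne_zero _)

/-- As the smoothing parameter `σ → 0⁺`, the GRNN output tends to the target of the unique
nearest training input. -/
theorem stmt13 (N m : ℕ) (hN : 1 ≤ N)
    (X : Fin N → EuclideanSpace ℝ (Fin m)) (y : Fin N → ℝ)
    (x : EuclideanSpace ℝ (Fin m))
    (k₀ : Fin N) (hk₀ : ∀ k, k ≠ k₀ → ‖x - X k₀‖ < ‖x - X k‖) :
    Filter.Tendsto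
      (fun σ : ℝ =>
        (∑ k, y k * Real.exp (-‖x - X k‖ ^ 2 / (2 * σ ^ 2))) /
          (∑ k, Real.exp (-‖x - X k‖ ^ 2 / (2 * σ ^ 2))))
      (nhdsWithin 0 (Set.Ioi 0)) (nhds (y k₀)) := by
  have hscale : Filter.Tendsto (fun σ : ℝ => (2 * σ ^ 2)⁻¹)
      (nhdsWithin 0 (Set.Ioi 0)) Filter.atTop := by
    refine Filter.Tendsto.inv_tendsto_nhdsGT_zero (tendsto_nhdsWithin_iff.2 ⟨?_, ?_⟩)
    · have hcont : Continuous fun σ : ℝ => 2 * σ ^ 2 := by fun_prop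
      simpa using (hcont.tendsto 0).mono_left nhdsWithin_le_nhds
    · filter_upwards [self_mem_nhdsWithin] with σ hσ
      have hpos : 0 < σ := hσ
      exact Set.mem_Ioi.2 (by positivity)
  have havg := tendsto_exp_weighted_average (fun k => ‖x - X k‖ ^ 2) y k₀
    fun k hk => pow_lt_pow_left₀ (hk₀ k hk) (norm_nonneg _) two_ne_zero
  simpa only [Function.comp_def, div_eq_mul_inv] using havg.comp hscale
end

section
/- Let H₀, H₁, …, H_m, P be Hermitian matrices in Matrix (Fin n) (Fin n) ℂ with H₀P = PH₀ and P positive semidefinite, let K > 0 be real, and let Ψ : ℝ → EuclideanSpace ℂ (Fin n) be differentiable and satisfy the closed-loop equation Ψ'(t) = −i·(H₀ + Σ_{k=1}^m f_k(t) H_k) Ψ(t) with f_k(t) = −K · Re ⟨Ψ(t), i·(H_k P − P H_k) Ψ(t)⟩. Then the real-valued Lyapunov function V(t) = ⟨Ψ(t), P Ψ(t)⟩ satisfies 0 ≤ V(t) ≤ V(0) for all t ≥ 0, and V(t) converges to a (nonnegative) limit as t → ∞. -/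
open scoped InnerProductSpace ComplexInnerProductSpace ComplexOrder

/-- Along the Schrödinger flow generated by the Hermitian matrix `A`, the expectation of `P`
evolves according to the commutator `i[A, P]`. -/
theorem hasDerivAt_re_inner_toEuclideanLin {n : ℕ} {A P : Matrix (Fin n) (Fin n) ℂ}
    (hA : A.IsHermitian) {Ψ : ℝ → EuclideanSpace ℂ (Fin n)} {t : ℝ}
    (hΨ : HasDerivAt Ψ ((-Complex.I) • Matrix.toEuclideanLin A (Ψ t)) t) :
    HasDerivAt (fun s => (⟪Ψ s, Matrix.toEuclideanLin P (Ψ s)⟫_ℂ).re)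
      (⟪Ψ t, Matrix.toEuclideanLin (Complex.I • (A * P - P * A)) (Ψ t)⟫_ℂ).re t := by
  have hPΨ : HasDerivAt (fun s => Matrix.toEuclideanLin P (Ψ s))
      (Matrix.toEuclideanLin P ((-Complex.I) • Matrix.toEuclideanLin A (Ψ t))) t :=
    ((Matrix.toEuclideanLin P).toContinuousLinearMap.restrictScalars ℝ).hasFDerivAt.comp_hasDerivAt
      t hΨ
  have hre := Complex.reCLM.hasFDerivAt.comp_hasDerivAt t (hΨ.inner ℂ hPΨ)
  refine hre.congr_deriv ?_
  have hsymm := Matrix.isSymmetric_toEuclideanLin_iff.mpr hA (Ψ t) (Matrix.toEuclideanLin P (Ψ t))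
  rw [Complex.reCLM_apply, inner_smul_left, hsymm, map_smul, map_smul, map_sub,
    Matrix.toLpLin_mul_same, Matrix.toLpLin_mul_same, LinearMap.smul_apply, LinearMap.sub_apply,
    LinearMap.comp_apply, LinearMap.comp_apply, inner_smul_right, inner_smul_right,
    inner_sub_right, map_neg, Complex.conj_I]
  congr 1
  ring

/-- For the closed-loop Lyapunov-controlled dynamics with `P` Hermitian, positive
semidefinite and commuting with `H₀`, the real-valued Lyapunov function
`V(t) = ⟪Ψ t, P Ψ t⟫` satisfies `0 ≤ V(t) ≤ V(0)` for all `t ≥ 0` and converges to a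
nonnegative limit as `t → ∞`. -/
theorem stmt14 (n m : ℕ)
    (H₀ : Matrix (Fin n) (Fin n) ℂ) (hH₀ : H₀.IsHermitian)
    (H : Fin m → Matrix (Fin n) (Fin n) ℂ) (hH : ∀ k, (H k).IsHermitian)
    (P : Matrix (Fin n) (Fin n) ℂ) (hP : P.IsHermitian) (hPsd : P.PosSemidef)
    (hcomm : H₀ * P = P * H₀)
    (K : ℝ) (hK : 0 < K)
    (f : Fin m → ℝ → ℝ)
    (Ψ : ℝ → EuclideanSpace ℂ (Fin n))
    (hf : ∀ k t, f k t =
      -K * (⟪Ψ t, Matrix.toEuclideanLin (Complex.I • (H k * P - P * H k)) (Ψ t)⟫_ℂ).re)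
    (hΨ : ∀ t, HasDerivAt Ψ
      ((-Complex.I) • Matrix.toEuclideanLin (H₀ + ∑ k, (f k t : ℂ) • H k) (Ψ t)) t) :
    (∀ t : ℝ, 0 ≤ t →
        0 ≤ (⟪Ψ t, Matrix.toEuclideanLin P (Ψ t)⟫_ℂ).re ∧
        (⟪Ψ t, Matrix.toEuclideanLin P (Ψ t)⟫_ℂ).re
          ≤ (⟪Ψ 0, Matrix.toEuclideanLin P (Ψ 0)⟫_ℂ).re)
      ∧ ∃ L : ℝ, 0 ≤ L ∧
        Filter.Tendsto (fun t => (⟪Ψ t, Matrix.toEuclideanLin P (Ψ t)⟫_ℂ).re)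
          Filter.atTop (nhds L) := by
  have hderiv : ∀ t, HasDerivAt (fun s => (⟪Ψ s, Matrix.toEuclideanLin P (Ψ s)⟫_ℂ).re)
      (-K * ∑ k, (⟪Ψ t, Matrix.toEuclideanLin
        (Complex.I • (H k * P - P * H k)) (Ψ t)⟫_ℂ).re ^ 2) t := by
    intro t
    have hA : (H₀ + ∑ k, (f k t : ℂ) • H k).IsHermitian := by
      simp only [Matrix.IsHermitian, Matrix.conjTranspose_add, Matrix.conjTranspose_sum,
        Matrix.conjTranspose_smul, hH₀.eq, (hH _).eq, RCLike.star_def, Complex.conj_ofReal]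
    refine (hasDerivAt_re_inner_toEuclideanLin hA (hΨ t)).congr_deriv ?_
    have hbracket : Complex.I • ((H₀ + ∑ k, (f k t : ℂ) • H k) * P
        - P * (H₀ + ∑ k, (f k t : ℂ) • H k))
        = ∑ k, (f k t : ℂ) • (Complex.I • (H k * P - P * H k)) := by
      simp only [add_mul, mul_add, hcomm, Finset.sum_mul, Finset.mul_sum, add_sub_add_left_eq_sub,
        ← Finset.sum_sub_distrib, Finset.smul_sum, smul_mul_assoc, mul_smul_comm, ← smul_sub]
      exact Finset.sum_congr rfl fun k _ => smul_comm _ _ _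
    rw [hbracket, map_sum, LinearMap.sum_apply, inner_sum, Complex.re_sum, Finset.mul_sum]
    refine Finset.sum_congr rfl fun k _ => ?_
    rw [map_smul, LinearMap.smul_apply, inner_smul_right, Complex.re_ofReal_mul, hf k t]
    ring
  have hanti : Antitone fun t => (⟪Ψ t, Matrix.toEuclideanLin P (Ψ t)⟫_ℂ).re := by
    refine antitone_of_deriv_nonpos (fun t => (hderiv t).differentiableAt) fun t => ?_
    rw [(hderiv t).deriv]
    exact mul_nonpos_of_nonpos_of_nonneg (neg_nonpos.mpr hK.le)
      (Finset.sum_nonneg fun k _ => sq_nonneg _)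
  have hnonneg : ∀ t, 0 ≤ (⟪Ψ t, Matrix.toEuclideanLin P (Ψ t)⟫_ℂ).re := fun t =>
    (Matrix.isPositive_toEuclideanLin_iff.mpr hPsd).re_inner_nonneg_right (Ψ t)
  refine ⟨fun t ht => ⟨hnonneg t, hanti ht⟩, _, le_ciInf hnonneg, ?_⟩
  exact tendsto_atTop_ciInf hanti ⟨0, Set.forall_mem_range.mpr hnonneg⟩
end
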